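/- arXiv:0710.2282 — 6 statements merged into one kernel-verified Lean document; each statement's English description precedes it below -/
import Mathlib

section
/- Suppose R is a ring with involution, the crossed-product conditions (C1)–(C5) hold, and w : G → R satisfies the w-conditions (W1)–(W4). Then the map σ of R∗_{c,τ}G to itself sending Σ_g r_g·g to Σ_g (w(g)·c_{g⁻¹}(r̄_g))·g⁻¹ is a ring involution on R∗_{c,τ}G: σ is additive, σ(1) = 1, σ(x·y) = σ(y)·σ(x) for all x,y, and σ∘σ = id. Moreover σ extends the involution of R (σ(r·e) = r̄·e) and σ(1·g) = w(g)·g⁻¹ for all g ∈ G. -/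
universe u v

variable {R : Type u} [Ring R] {G : Type v} [Group G]

/-- (C1): `c_{τ(g,g')} ∘ c_{gg'} = c_g ∘ c_{g'}`, where `c_u` is conjugation by the unit `u`. -/
def CondC1 (c : G → R ≃+* R) (τ : G → G → Rˣ) : Prop :=
  ∀ (g g' : G) (r : R),
    (τ g g' : R) * c (g * g') r * (((τ g g')⁻¹ : Rˣ) : R) = c g (c g' r)

/-- (C2): `τ(g,g')·τ(gg',g'') = c_g(τ(g',g''))·τ(g,g'g'')`. -/
def CondC2 (c : G → R ≃+* R) (τ : G → G → Rˣ) : Prop :=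
  ∀ g g' g'' : G,
    (τ g g' : R) * ((τ (g * g') g'' : Rˣ) : R) =
      c g ((τ g' g'' : Rˣ) : R) * ((τ g (g' * g'') : Rˣ) : R)

/-- (C3): `c_e = id`. -/
def CondC3 (c : G → R ≃+* R) : Prop := c (1 : G) = RingEquiv.refl R

/-- (C4): `τ(e,g) = 1`. -/
def CondC4 (τ : G → G → Rˣ) : Prop := ∀ g : G, τ 1 g = 1

/-- (C5): `τ(g,e) = 1`. -/
def CondC5 (τ : G → G → Rˣ) : Prop := ∀ g : G, τ g 1 = 1


/-- The multiplication of the crossed product `R ∗_{c,τ} G` on the free left `R`-module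
`G →₀ R` on `G`: the unique biadditive map with
`(λ·g)·(μ·h) = (λ · c_g(μ) · τ(g,h)) · (gh)`. -/
noncomputable def crossedMul (c : G → R ≃+* R) (τ : G → G → Rˣ) (x y : G →₀ R) : G →₀ R :=
  x.sum fun g r => y.sum fun h s => Finsupp.single (g * h) (r * c g s * ((τ g h : Rˣ) : R))

/-- A ring involution: `σ 1 = 1`, `σ` is additive, anti-multiplicative and of order two. -/
def IsRingInvolution (σ : R → R) : Prop :=
  σ 1 = 1 ∧ (∀ a b : R, σ (a + b) = σ a + σ b) ∧
    (∀ a b : R, σ (a * b) = σ b * σ a) ∧ ∀ a : R, σ (σ a) = a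

/-- (W1): `w(e) = 1`. -/
def CondW1 (w : G → R) : Prop := w (1 : G) = 1

/-- (W2): `w(gh) = w(h)·c_{h⁻¹}(w(g))·τ(h⁻¹,g⁻¹)·c_{(gh)⁻¹}(τ(g,h)‾)⁻¹`
(the last factor is the ring inverse of `c_{(gh)⁻¹}(σ(τ(g,h)))`, taken via `Ring.inverse`). -/
def CondW2 (σ : R → R) (c : G → R ≃+* R) (τ : G → G → Rˣ) (w : G → R) : Prop :=
  ∀ g h : G,
    w (g * h) =
      w h * c h⁻¹ (w g) * ((τ h⁻¹ g⁻¹ : Rˣ) : R) *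
        Ring.inverse (c (g * h)⁻¹ (σ ((τ g h : Rˣ) : R)))

/-- (W3): `σ(w(g)) = w(g)·c_g⁻¹(τ(g,g⁻¹)·(σ(τ(g,g⁻¹)))⁻¹)`, where `c_g⁻¹` is the inverse
automorphism of `c_g`. -/
def CondW3 (σ : R → R) (c : G → R ≃+* R) (τ : G → G → Rˣ) (w : G → R) : Prop :=
  ∀ g : G,
    σ (w g) =
      w g * (c g).symm (((τ g g⁻¹ : Rˣ) : R) * Ring.inverse (σ ((τ g g⁻¹ : Rˣ) : R)))

/-- (W4): `σ(c_g(r)) = c_g((w(g)·τ(g⁻¹,g))⁻¹ · σ(r) · (w(g)·τ(g⁻¹,g)))`. -/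
def CondW4 (σ : R → R) (c : G → R ≃+* R) (τ : G → G → Rˣ) (w : G → R) : Prop :=
  ∀ (g : G) (r : R),
    σ (c g r) =
      c g (Ring.inverse (w g * ((τ g⁻¹ g : Rˣ) : R)) * σ r *
        (w g * ((τ g⁻¹ g : Rˣ) : R)))

/-- The candidate involution on the crossed product:
`Σ_g r_g·g ↦ Σ_g (w(g)·c_{g⁻¹}(σ(r_g)))·g⁻¹`. -/
noncomputable def crossedStar (σ : R → R) (c : G → R ≃+* R) (w : G → R)
    (x : G →₀ R) : G →₀ R :=
  x.sum fun g r => Finsupp.single g⁻¹ (w g * c g⁻¹ (σ r))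

namespace IsRingInvolution

variable {σ : R → R}

theorem map_one (hσ : IsRingInvolution σ) : σ 1 = 1 := hσ.1

theorem map_add (hσ : IsRingInvolution σ) (a b : R) : σ (a + b) = σ a + σ b := hσ.2.1 a b

theorem map_mul (hσ : IsRingInvolution σ) (a b : R) : σ (a * b) = σ b * σ a := hσ.2.2.1 a b

theorem involutive (hσ : IsRingInvolution σ) (a : R) : σ (σ a) = a := hσ.2.2.2 a

theorem map_zero (hσ : IsRingInvolution σ) : σ 0 = 0 := by
  simpa using hσ.map_add 0 0

theorem isUnit_map (hσ : IsRingInvolution σ) (u : Rˣ) : IsUnit (σ (u : R)) :=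
  ⟨⟨σ u, σ (u⁻¹ : Rˣ), by rw [← hσ.map_mul, Units.inv_mul, hσ.map_one],
    by rw [← hσ.map_mul, Units.mul_inv, hσ.map_one]⟩, rfl⟩

end IsRingInvolution

section CrossedMul

variable (c : G → R ≃+* R) (τ : G → G → Rˣ)

@[simp]
theorem crossedMul_single_single (g h : G) (r s : R) :
    crossedMul c τ (Finsupp.single g r) (Finsupp.single h s) =
      Finsupp.single (g * h) (r * c g s * (τ g h : R)) := by
  simp [crossedMul]

@[simp]
theorem crossedMul_zero_left (y : G →₀ R) : crossedMul c τ 0 y = 0 := by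
  simp [crossedMul]

@[simp]
theorem crossedMul_zero_right (x : G →₀ R) : crossedMul c τ x 0 = 0 := by
  simp [crossedMul]

theorem crossedMul_add_left (x x' y : G →₀ R) :
    crossedMul c τ (x + x') y = crossedMul c τ x y + crossedMul c τ x' y := by
  classical
  unfold crossedMul
  refine Finsupp.sum_add_index' (by simp) fun g r r' => ?_
  simp only [add_mul, Finsupp.single_add, Finsupp.sum_add]

theorem crossedMul_add_right (x y y' : G →₀ R) :
    crossedMul c τ x (y + y') = crossedMul c τ x y + crossedMul c τ x y' := by
  classical
  unfold crossedMul
  rw [← Finsupp.sum_add]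
  refine Finsupp.sum_congr fun g _ => ?_
  refine Finsupp.sum_add_index' (by simp) fun h s s' => ?_
  simp only [map_add, mul_add, add_mul, Finsupp.single_add]

end CrossedMul

section CrossedStar

variable {c : G → R ≃+* R} {τ : G → G → Rˣ} {σ : R → R} {w : G → R}

@[simp]
theorem crossedStar_zero : crossedStar σ c w 0 = 0 := by
  simp [crossedStar]

theorem crossedStar_single (hσ : IsRingInvolution σ) (g : G) (r : R) :
    crossedStar σ c w (Finsupp.single g r) =
      Finsupp.single g⁻¹ (w g * c g⁻¹ (σ r)) := by
  simp [crossedStar, hσ.map_zero]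

theorem crossedStar_add (hσ : IsRingInvolution σ) (x y : G →₀ R) :
    crossedStar σ c w (x + y) = crossedStar σ c w x + crossedStar σ c w y := by
  classical
  refine Finsupp.sum_add_index' (by simp [hσ.map_zero]) fun g r s => ?_
  simp only [hσ.map_add, map_add, mul_add, Finsupp.single_add]

/-- (W2) with its last factor moved to the other side. -/
theorem CondW2.mul_map_eq (hσ : IsRingInvolution σ) (hw2 : CondW2 σ c τ w) (g h : G) :
    w (g * h) * c (g * h)⁻¹ (σ (τ g h : R)) = w h * c h⁻¹ (w g) * (τ h⁻¹ g⁻¹ : R) := by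
  rw [hw2 g h, mul_assoc, Ring.inverse_mul_cancel _ ((hσ.isUnit_map _).map (c (g * h)⁻¹)),
    mul_one]

theorem CondW2.inv_mul_eq_one (h3 : CondC3 c) (hw1 : CondW1 w) (hw2 : CondW2 σ c τ w) (g : G) :
    w g⁻¹ * c g (w g) * ((τ g g⁻¹ : R) * Ring.inverse (σ (τ g g⁻¹ : R))) = 1 := by
  have h := hw2 g g⁻¹
  rw [CondC3] at h3
  rw [mul_inv_cancel, inv_inv, inv_one, h3, hw1, RingEquiv.refl_apply] at h
  rw [← mul_assoc]
  exact h.symm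

theorem CondW2.isUnit (hσ : IsRingInvolution σ) (h3 : CondC3 c) (hw1 : CondW1 w)
    (hw2 : CondW2 σ c τ w) (g : G) : IsUnit (w g) := by
  have right_inv : ∃ b, w g * b = 1 := by
    have h := hw2.inv_mul_eq_one h3 hw1 g⁻¹
    rw [inv_inv, mul_assoc] at h
    exact ⟨_, h⟩
  have left_inv : ∃ a, a * w g = 1 := by
    have hu : IsUnit ((τ g g⁻¹ : R) * Ring.inverse (σ (τ g g⁻¹ : R))) :=
      (τ g g⁻¹).isUnit.mul (hσ.isUnit_map _).ringInverse
    obtain ⟨u, hu⟩ := hu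
    have h := hw2.inv_mul_eq_one h3 hw1 g
    rw [← hu, Units.mul_eq_one_iff_eq_inv] at h
    refine ⟨(c g).symm (u * w g⁻¹), (c g).injective ?_⟩
    rw [map_mul, RingEquiv.apply_symm_apply, mul_assoc, h, Units.mul_inv, map_one]
  obtain ⟨b, hb⟩ := right_inv
  obtain ⟨a, ha⟩ := left_inv
  exact isUnit_iff_exists_and_exists.2 ⟨⟨b, hb⟩, ⟨a, ha⟩⟩

/-- Conjugating by `w g` compensates for the failure of `σ` to commute with `c g`. -/
theorem CondW4.mul_map_inv_eq (h1 : CondC1 c τ) (h3 : CondC3 c) (hw4 : CondW4 σ c τ w)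
    {g : G} (hw : IsUnit (w g)) (s : R) :
    w g * c g⁻¹ (σ (c g s)) = σ s * w g := by
  rw [CondC3] at h3
  obtain ⟨u, hu⟩ := hw
  rw [hw4 g s, ← h1, inv_mul_cancel, h3, RingEquiv.refl_apply, ← hu, ← Units.val_mul,
    Ring.inverse_unit, mul_inv_rev]
  simp only [Units.val_mul, mul_assoc, Units.mul_inv_cancel_left, Units.mul_inv, mul_one]

theorem crossedStar_mul (hσ : IsRingInvolution σ) (h1 : CondC1 c τ) (h3 : CondC3 c)
    (hw1 : CondW1 w) (hw2 : CondW2 σ c τ w) (hw4 : CondW4 σ c τ w) (x y : G →₀ R) :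
    crossedStar σ c w (crossedMul c τ x y) =
      crossedMul c τ (crossedStar σ c w y) (crossedStar σ c w x) := by
  induction x using Finsupp.induction_linear with
  | zero => simp
  | add x x' hx hx' =>
    rw [crossedMul_add_left, crossedStar_add hσ, crossedStar_add hσ, crossedMul_add_right, hx, hx']
  | single g r =>
    induction y using Finsupp.induction_linear with
    | zero => simp
    | add y y' hy hy' =>
      rw [crossedMul_add_right, crossedStar_add hσ, crossedStar_add hσ, crossedMul_add_left, hy,
        hy']
    | single h s =>
      have twist (a : R) : (τ h⁻¹ g⁻¹ : R) * c (g * h)⁻¹ a =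
          c h⁻¹ (c g⁻¹ a) * (τ h⁻¹ g⁻¹ : R) := by
        rw [← h1, Units.inv_mul_cancel_right, mul_inv_rev]
      rw [crossedMul_single_single, crossedStar_single hσ, crossedStar_single hσ,
        crossedStar_single hσ, crossedMul_single_single, mul_inv_rev g h, ← mul_inv_rev g h]
      congr 1
      calc w (g * h) * c (g * h)⁻¹ (σ (r * c g s * (τ g h : R)))
          = w (g * h) * c (g * h)⁻¹ (σ (τ g h : R)) * c (g * h)⁻¹ (σ (c g s) * σ r) := by
            rw [hσ.map_mul, hσ.map_mul, map_mul, mul_assoc]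
        _ = w h * c h⁻¹ (w g * c g⁻¹ (σ (c g s)) * c g⁻¹ (σ r)) * (τ h⁻¹ g⁻¹ : R) := by
            rw [hw2.mul_map_eq hσ, mul_assoc _ (τ h⁻¹ g⁻¹ : R), twist]
            simp only [map_mul, mul_assoc]
        _ = w h * c h⁻¹ (σ s) * c h⁻¹ (w g * c g⁻¹ (σ r)) * (τ h⁻¹ g⁻¹ : R) := by
            rw [hw4.mul_map_inv_eq h1 h3 (hw2.isUnit hσ h3 hw1 g)]
            simp only [map_mul, mul_assoc]

theorem crossedStar_crossedStar (hσ : IsRingInvolution σ) (h1 : CondC1 c τ) (h3 : CondC3 c)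
    (hw1 : CondW1 w) (hw2 : CondW2 σ c τ w) (hw3 : CondW3 σ c τ w) (hw4 : CondW4 σ c τ w)
    (x : G →₀ R) : crossedStar σ c w (crossedStar σ c w x) = x := by
  induction x using Finsupp.induction_linear with
  | zero => simp
  | add x y hx hy => rw [crossedStar_add hσ, crossedStar_add hσ, hx, hy]
  | single g r =>
    have key := hw4.mul_map_inv_eq h1 h3 (hw2.isUnit hσ h3 hw1 g⁻¹) (σ r)
    rw [inv_inv, hσ.involutive] at key
    rw [crossedStar_single hσ, crossedStar_single hσ, inv_inv, hσ.map_mul, map_mul, ← mul_assoc,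
      key, hw3 g, map_mul, RingEquiv.apply_symm_apply, mul_assoc, ← mul_assoc (w g⁻¹),
      hw2.inv_mul_eq_one h3 hw1, mul_one]

end CrossedStar

/-- under (C1)–(C5) and the `w`-conditions (W1)–(W4), the map
`σ̂ : Σ_g r_g·g ↦ Σ_g (w(g)·c_{g⁻¹}(σ(r_g)))·g⁻¹` is a ring involution on `R ∗_{c,τ} G`:
it is additive, sends `1` to `1`, is anti-multiplicative and of order two; moreover it
extends the involution of `R` and sends `1·g` to `w(g)·g⁻¹`. -/
theorem crossedStar_is_ring_involution
    (c : G → R ≃+* R) (τ : G → G → Rˣ) (σ : R → R) (w : G → R)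
    (hσ : IsRingInvolution σ)
    (h1 : CondC1 c τ) (h2 : CondC2 c τ) (h3 : CondC3 c) (h4 : CondC4 τ) (h5 : CondC5 τ)
    (hw1 : CondW1 w) (hw2 : CondW2 σ c τ w) (hw3 : CondW3 σ c τ w) (hw4 : CondW4 σ c τ w) :
    (∀ x y : G →₀ R,
        crossedStar σ c w (x + y) = crossedStar σ c w x + crossedStar σ c w y) ∧
    crossedStar σ c w (Finsupp.single (1 : G) (1 : R)) = Finsupp.single (1 : G) (1 : R) ∧
    (∀ x y : G →₀ R,
        crossedStar σ c w (crossedMul c τ x y) =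
          crossedMul c τ (crossedStar σ c w y) (crossedStar σ c w x)) ∧
    (∀ x : G →₀ R, crossedStar σ c w (crossedStar σ c w x) = x) ∧
    (∀ r : R, crossedStar σ c w (Finsupp.single (1 : G) r) = Finsupp.single (1 : G) (σ r)) ∧
    (∀ g : G, crossedStar σ c w (Finsupp.single g (1 : R)) = Finsupp.single g⁻¹ (w g)) := by
  have single_one (r : R) :
      crossedStar σ c w (Finsupp.single (1 : G) r) = Finsupp.single (1 : G) (σ r) := by
    rw [CondC3] at h3
    rw [crossedStar_single hσ, inv_one, h3, hw1, one_mul, RingEquiv.refl_apply]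
  refine ⟨crossedStar_add hσ, by rw [single_one, hσ.map_one],
    crossedStar_mul hσ h1 h3 hw1 hw2 hw4, crossedStar_crossedStar hσ h1 h3 hw1 hw2 hw3 hw4,
    single_one, fun g => ?_⟩
  rw [crossedStar_single hσ, hσ.map_one, map_one, mul_one]
end

section
/- Suppose the crossed-product conditions (C1)–(C5) hold, R carries an involution r ↦ r̄, and w : G → R is a map such that R∗_{c,τ}G admits an involution σ (additive, σ(1)=1, σ(x·y) = σ(y)·σ(x), σ∘σ = id) with σ(r·e) = r̄·e for all r ∈ R and σ(1·g) = w(g)·g⁻¹ for all g ∈ G. Then w satisfies all four w-conditions (W1)–(W4), and moreover each w(g) is a unit of R with w(g)⁻¹ = c_{g⁻¹}(w(g⁻¹))·τ(g⁻¹,g)·(τ(g⁻¹,g)‾)⁻¹. -/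
universe u v

variable {R : Type u} [Ring R] {G : Type v} [Group G]

theorem crossedMul_single (c : G → R ≃+* R) (τ : G → G → Rˣ) (g h : G) (r s : R) :
    crossedMul c τ (Finsupp.single g r) (Finsupp.single h s) =
      Finsupp.single (g * h) (r * c g s * ((τ g h : Rˣ) : R)) := by
  simp [crossedMul]

theorem IsRingInvolution.isUnit {σ : R → R} (hσ : IsRingInvolution σ) (u : Rˣ) :
    IsUnit (σ (u : R)) := by
  obtain ⟨hσ1, -, hσm, -⟩ := hσ
  refine ⟨⟨σ u, σ ((u⁻¹ : Rˣ) : R), ?_, ?_⟩, rfl⟩ <;> rw [← hσm] <;> simp [hσ1]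

/-- (C2) for the triple `g, g⁻¹, g`, together with the normalizations of `τ`. -/
theorem CondC2.map_inv_self {c : G → R ≃+* R} {τ : G → G → Rˣ}
    (h2 : CondC2 c τ) (h4 : CondC4 τ) (h5 : CondC5 τ) (g : G) :
    c g ((τ g⁻¹ g : Rˣ) : R) = ((τ g g⁻¹ : Rˣ) : R) := by
  have h := h2 g g⁻¹ g
  rw [mul_inv_cancel, inv_mul_cancel, h4, h5] at h
  simpa using h.symm

/-- under (C1)–(C5), if `R` carries an involution `σ` and `R ∗_{c,τ} G` admits an
involution `T` (additive, unital, anti-multiplicative, of order two) extending `σ` with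
`T(1·g) = w(g)·g⁻¹`, then `w` satisfies the `w`-conditions (W1)–(W4); moreover each `w(g)` is
a unit of `R` with two-sided inverse
`c_{g⁻¹}(w(g⁻¹))·τ(g⁻¹,g)·(σ(τ(g⁻¹,g)))⁻¹`. -/
theorem w_conditions_necessary
    (c : G → R ≃+* R) (τ : G → G → Rˣ) (σ : R → R) (w : G → R)
    (hσ : IsRingInvolution σ)
    (h1 : CondC1 c τ) (h2 : CondC2 c τ) (h3 : CondC3 c) (h4 : CondC4 τ) (h5 : CondC5 τ)
    (T : (G →₀ R) → (G →₀ R))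
    (hadd : ∀ x y : G →₀ R, T (x + y) = T x + T y)
    (hone : T (Finsupp.single (1 : G) (1 : R)) = Finsupp.single (1 : G) (1 : R))
    (hanti : ∀ x y : G →₀ R, T (crossedMul c τ x y) = crossedMul c τ (T y) (T x))
    (hinvol : ∀ x : G →₀ R, T (T x) = x)
    (hext : ∀ r : R, T (Finsupp.single (1 : G) r) = Finsupp.single (1 : G) (σ r))
    (hgrp : ∀ g : G, T (Finsupp.single g (1 : R)) = Finsupp.single g⁻¹ (w g)) :
    CondW1 w ∧ CondW2 σ c τ w ∧ CondW3 σ c τ w ∧ CondW4 σ c τ w ∧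
    ∀ g : G,
      w g * (c g⁻¹ (w g⁻¹) * ((τ g⁻¹ g : Rˣ) : R) *
          Ring.inverse (σ ((τ g⁻¹ g : Rˣ) : R))) = 1 ∧
      (c g⁻¹ (w g⁻¹) * ((τ g⁻¹ g : Rˣ) : R) *
          Ring.inverse (σ ((τ g⁻¹ g : Rˣ) : R))) * w g = 1 := by
  have hc1 : ∀ r : R, c 1 r = r := fun r => by rw [h3]; rfl
  have hT : ∀ (g : G) (r : R),
      T (Finsupp.single g r) = Finsupp.single g⁻¹ (w g * c g⁻¹ (σ r)) := by
    intro g r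
    have h := hanti (Finsupp.single 1 r) (Finsupp.single g 1)
    rw [hext, hgrp, crossedMul_single, crossedMul_single, h4, h5] at h
    simpa using h
  have hw1 : w 1 = 1 := by
    have h := hgrp 1
    rw [hone, inv_one] at h
    exact (Finsupp.single_injective _ h).symm
  have hmul : ∀ g h : G, w (g * h) * c (g * h)⁻¹ (σ ((τ g h : Rˣ) : R)) =
      w h * c h⁻¹ (w g) * ((τ h⁻¹ g⁻¹ : Rˣ) : R) := by
    intro g h
    have H := hanti (Finsupp.single g 1) (Finsupp.single h 1)
    rw [hgrp, hgrp, crossedMul_single, crossedMul_single, hT, ← mul_inv_rev, map_one,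
      one_mul, one_mul] at H
    exact Finsupp.single_injective _ H
  have htwice : ∀ g : G, w g⁻¹ * c g (σ (w g)) = 1 := by
    intro g
    have H := hinvol (Finsupp.single g 1)
    rw [hgrp, hT, inv_inv] at H
    exact Finsupp.single_injective _ H
  have hcomm : ∀ (g : G) (r : R), w g * c g⁻¹ (σ (c g r)) = σ r * w g := by
    intro g r
    have H := hanti (Finsupp.single g 1) (Finsupp.single 1 r)
    rw [hgrp, hext, crossedMul_single, crossedMul_single, hT, h4, h5, hc1, one_mul, mul_one,
      one_mul, Units.val_one, mul_one, mul_one] at H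
    exact Finsupp.single_injective _ H
  have hright : ∀ g : G, w g * (c g⁻¹ (w g⁻¹) * ((τ g⁻¹ g : Rˣ) : R) *
      Ring.inverse (σ ((τ g⁻¹ g : Rˣ) : R))) = 1 := by
    intro g
    have H := hmul g⁻¹ g
    rw [inv_mul_cancel, hw1, inv_one, hc1, one_mul, inv_inv] at H
    rw [← mul_assoc, ← mul_assoc, ← H]
    exact Ring.mul_inverse_cancel _ (hσ.isUnit _)
  have hleft : ∀ g : G, (c g⁻¹ (w g⁻¹) * ((τ g⁻¹ g : Rˣ) : R) *
      Ring.inverse (σ ((τ g⁻¹ g : Rˣ) : R))) * w g = 1 := by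
    intro g
    set v := c g⁻¹ (w g⁻¹) * ((τ g⁻¹ g : Rˣ) : R) *
      Ring.inverse (σ ((τ g⁻¹ g : Rˣ) : R)) with hv
    have hvr : v * (σ ((τ g⁻¹ g : Rˣ) : R) * (((τ g⁻¹ g)⁻¹ : Rˣ) : R) *
        c g⁻¹ (c g (σ (w g)))) = 1 := by
      rw [hv, mul_assoc (σ _), ← mul_assoc (_ * _ * _),
        Ring.inverse_mul_cancel_right _ _ (hσ.isUnit _), ← mul_assoc,
        Units.mul_inv_cancel_right, ← map_mul, htwice, map_one]
    rwa [← left_inv_eq_right_inv (hright g) hvr] at hvr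
  have hunit : ∀ g : G, IsUnit (w g) := fun g => ⟨⟨w g, _, hright g, hleft g⟩, rfl⟩
  refine ⟨hw1, ?_, ?_, ?_, fun g => ⟨hright g, hleft g⟩⟩
  · intro g h
    rw [← hmul, Ring.mul_inverse_cancel_right _ _ ((hσ.isUnit _).map (c (g * h)⁻¹))]
  · intro g
    apply (c g).injective
    have H := hleft g⁻¹
    rw [inv_inv] at H
    rw [map_mul, RingEquiv.apply_symm_apply, ← mul_assoc]
    exact (left_inv_eq_right_inv H (htwice g)).symm
  · intro g r
    have H : c g⁻¹ (σ (c g r)) = Ring.inverse (w g) * (σ r * w g) := by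
      rw [← hcomm, Ring.inverse_mul_cancel_left _ _ (hunit g)]
    have h1' := h1 g g⁻¹ (σ (c g r))
    rw [mul_inv_cancel, hc1, H, ← h2.map_inv_self h4 h5] at h1'
    have hinv : Ring.inverse (w g * ((τ g⁻¹ g : Rˣ) : R)) =
        (((τ g⁻¹ g)⁻¹ : Rˣ) : R) * Ring.inverse (w g) := by
      obtain ⟨u, hu⟩ := hunit g
      rw [← hu, ← Units.val_mul, Ring.inverse_unit, Ring.inverse_unit, mul_inv_rev,
        Units.val_mul]
    have hτ : c g (((τ g⁻¹ g)⁻¹ : Rˣ) : R) = (((τ g g⁻¹)⁻¹ : Rˣ) : R) := by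
      refine left_inv_eq_right_inv ?_ (τ g g⁻¹).mul_inv
      rw [← h2.map_inv_self h4 h5, ← map_mul, Units.inv_mul, map_one]
    rw [hinv]
    calc σ (c g r) = (((τ g g⁻¹)⁻¹ : Rˣ) : R) *
          (((τ g g⁻¹ : Rˣ) : R) * σ (c g r) * (((τ g g⁻¹)⁻¹ : Rˣ) : R)) *
            ((τ g g⁻¹ : Rˣ) : R) := by simp [mul_assoc]
      _ = _ := by
        rw [← h2.map_inv_self h4 h5 g, h1', ← hτ, ← map_mul, ← map_mul]
        simp only [mul_assoc]
end

section
/- Suppose the crossed-product conditions (C1)–(C5) hold, R carries an involution r ↦ r̄, and w : G → R satisfies the w-conditions (W1) and (W2). Then for every g ∈ G one has 1 = w(g⁻¹)·c_g(w(g))·τ(g,g⁻¹)·(τ(g,g⁻¹)‾)⁻¹; consequently each w(g) is a (two-sided) unit of R with inverse w(g)⁻¹ = c_{g⁻¹}(w(g⁻¹))·τ(g⁻¹,g)·(τ(g⁻¹,g)‾)⁻¹. -/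
universe u v

variable {R : Type u} [Ring R] {G : Type v} [Group G]

/-- under (C1)–(C5), an involution `σ` of `R`, and conditions (W1), (W2),
for every `g` one has `1 = w(g⁻¹)·c_g(w(g))·τ(g,g⁻¹)·(σ(τ(g,g⁻¹)))⁻¹`; consequently each
`w(g)` is a two-sided unit of `R` with inverse
`c_{g⁻¹}(w(g⁻¹))·τ(g⁻¹,g)·(σ(τ(g⁻¹,g)))⁻¹`. -/
theorem w_is_unit_of_W1_W2
    (c : G → R ≃+* R) (τ : G → G → Rˣ) (σ : R → R) (w : G → R)
    (hσ : IsRingInvolution σ)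
    (h1 : CondC1 c τ) (h2 : CondC2 c τ) (h3 : CondC3 c) (h4 : CondC4 τ) (h5 : CondC5 τ)
    (hw1 : CondW1 w) (hw2 : CondW2 σ c τ w) :
    (∀ g : G,
      (1 : R) =
        w g⁻¹ * c g (w g) * ((τ g g⁻¹ : Rˣ) : R) *
          Ring.inverse (σ ((τ g g⁻¹ : Rˣ) : R))) ∧
    (∀ g : G,
      w g * (c g⁻¹ (w g⁻¹) * ((τ g⁻¹ g : Rˣ) : R) *
          Ring.inverse (σ ((τ g⁻¹ g : Rˣ) : R))) = 1 ∧
      (c g⁻¹ (w g⁻¹) * ((τ g⁻¹ g : Rˣ) : R) *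
          Ring.inverse (σ ((τ g⁻¹ g : Rˣ) : R))) * w g = 1) := by
  have hone : ∀ g : G,
      (1 : R) = w g⁻¹ * c g (w g) * ((τ g g⁻¹ : Rˣ) : R) *
        Ring.inverse (σ ((τ g g⁻¹ : Rˣ) : R)) := by
    intro g
    have h := hw2 g g⁻¹
    rw [mul_inv_cancel, inv_inv, inv_one, h3, RingEquiv.refl_apply] at h
    rwa [show w 1 = 1 from hw1] at h
  have hright : ∀ g : G,
      w g * (c g⁻¹ (w g⁻¹) * ((τ g⁻¹ g : Rˣ) : R) *
        Ring.inverse (σ ((τ g⁻¹ g : Rˣ) : R))) = 1 := by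
    intro g
    have h := hone g⁻¹
    rw [inv_inv] at h
    simpa only [mul_assoc] using h.symm
  refine ⟨hone, fun g => ⟨hright g, ?_⟩⟩
  have hστ : IsUnit (σ ((τ g g⁻¹ : Rˣ) : R)) :=
    ⟨⟨_, σ (((τ g g⁻¹)⁻¹ : Rˣ) : R),
      by rw [← hσ.2.2.1, Units.inv_mul, hσ.1],
      by rw [← hσ.2.2.1, Units.mul_inv, hσ.1]⟩, rfl⟩
  obtain ⟨u, hu⟩ := (τ g g⁻¹).isUnit.mul hστ.ringInverse
  have h := hone g
  rw [mul_assoc (w g⁻¹ * _), ← hu] at h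
  have hinv : w g⁻¹ * c g (w g) = ((u⁻¹ : Rˣ) : R) :=
    Units.eq_inv_of_mul_eq_one_right h.symm
  have hleft : (c g).symm (u * w g⁻¹) * w g = 1 := by
    apply (c g).injective
    rw [map_mul, RingEquiv.apply_symm_apply, mul_assoc, hinv, Units.mul_inv, map_one]
  rw [← left_inv_eq_right_inv hleft (hright g), hleft]
end

section
/- Let 1 → H → G →p→ Q → 1 be an extension of groups (p : G → Q surjective with kernel H) and let s : Q → G be a set-theoretic section of p with s(e) = e (s is not assumed to be a homomorphism). Let R be a ring. Define c : Q → Aut(R[H]) by c_q(Σ_h λ_h·h) = Σ_h λ_h·(s(q)·h·s(q)⁻¹), and τ : Q × Q → (R[H])ˣ by τ(q,q') = s(q)·s(q')·s(qq')⁻¹ (an element of H, viewed as a unit of the group ring R[H]). Then (c,τ) satisfy the crossed-product conditions (C1)–(C5), and the map R[H]∗_{c,τ}Q → R[G] sending Σ_q λ_q·q to Σ_q i(λ_q)·s(q), where i : R[H] → R[G] is the ring homomorphism induced by the inclusion H → G, is an isomorphism of rings. -/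
universe u v

section Extension

variable {G Q : Type u} [Group G] [Group Q]

/-- Conjugation by `s q` as an automorphism of the kernel of `p`. -/
def kerConj (p : G →* Q) (s : Q → G) (hs : ∀ q, p (s q) = q) (q : Q) :
    p.ker ≃* p.ker where
  toFun h := ⟨s q * (h : G) * (s q)⁻¹, by
    have hh : p (h : G) = 1 := h.2
    simp [MonoidHom.mem_ker, hh, hs]⟩
  invFun h := ⟨(s q)⁻¹ * (h : G) * s q, by
    have hh : p (h : G) = 1 := h.2
    simp [MonoidHom.mem_ker, hh, hs]⟩
  left_inv h := by
    ext
    simp only []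
    group
  right_inv h := by
    ext
    simp only []
    group
  map_mul' a b := by
    ext
    simp only [Subgroup.coe_mul]
    group

variable (R : Type v) [Ring R]

/-- The map `c : Q → Aut(R[H])`, `c_q(Σ_h λ_h·h) = Σ_h λ_h·(s(q)·h·s(q)⁻¹)`. -/
noncomputable def extConj (p : G →* Q) (s : Q → G) (hs : ∀ q, p (s q) = q) (q : Q) :
    MonoidAlgebra R ↥p.ker ≃+* MonoidAlgebra R ↥p.ker :=
  (MonoidAlgebra.domCongr ℕ R (kerConj p s hs q)).toRingEquiv

/-- The element `s(q)·s(q')·s(qq')⁻¹` of the kernel of `p`. -/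
def extCocycleElt (p : G →* Q) (s : Q → G) (hs : ∀ q, p (s q) = q) (q q' : Q) :
    p.ker :=
  ⟨s q * s q' * (s (q * q'))⁻¹, by
    simp only [MonoidHom.mem_ker, map_mul, map_inv, hs]
    group⟩

/-- The map `τ : Q × Q → (R[H])ˣ`, `τ(q,q') = s(q)·s(q')·s(qq')⁻¹`, an element of `H` viewed
as a unit of the group ring `R[H]`. -/
noncomputable def extCocycle (p : G →* Q) (s : Q → G) (hs : ∀ q, p (s q) = q) (q q' : Q) :
    (MonoidAlgebra R ↥p.ker)ˣ :=
  Units.map (MonoidAlgebra.of R ↥p.ker : ↥p.ker →* MonoidAlgebra R ↥p.ker)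
    (toUnits (extCocycleElt p s hs q q'))

/-- The comparison map `R[H] ∗_{c,τ} Q → R[G]`, `Σ_q λ_q·q ↦ Σ_q i(λ_q)·s(q)`, where
`i : R[H] → R[G]` is induced by the inclusion of the kernel. -/
noncomputable def extCompare (p : G →* Q) (s : Q → G)
    (x : Q →₀ MonoidAlgebra R ↥p.ker) : MonoidAlgebra R G :=
  x.sum fun q lam =>
    (MonoidAlgebra.mapDomainRingHom R p.ker.subtype lam) * MonoidAlgebra.single (s q) 1

variable {R} in
lemma extConj_single (p : G →* Q) (s : Q → G) (hs : ∀ q, p (s q) = q) (q : Q)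
    (h : p.ker) (r : R) :
    extConj R p s hs q (MonoidAlgebra.single h r) =
      MonoidAlgebra.single (kerConj p s hs q h) r :=
  MonoidAlgebra.domCongr_single (R := ℕ) (A := R) ..

lemma extCocycle_val (p : G →* Q) (s : Q → G) (hs : ∀ q, p (s q) = q) (q q' : Q) :
    (extCocycle R p s hs q q' : MonoidAlgebra R ↥p.ker) =
      MonoidAlgebra.single (extCocycleElt p s hs q q') 1 := rfl

lemma extCocycle_inv_val (p : G →* Q) (s : Q → G) (hs : ∀ q, p (s q) = q) (q q' : Q) :
    (((extCocycle R p s hs q q')⁻¹ : (MonoidAlgebra R ↥p.ker)ˣ) : MonoidAlgebra R ↥p.ker) =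
      MonoidAlgebra.single (extCocycleElt p s hs q q')⁻¹ 1 := rfl

lemma condC1_ext (p : G →* Q) (s : Q → G) (hs : ∀ q, p (s q) = q) :
    CondC1 (extConj R p s hs) (extCocycle R p s hs) := by
  intro q q' x
  induction x using MonoidAlgebra.induction_linear with
  | zero => simp
  | add x y hx hy => simp only [map_add, mul_add, add_mul, hx, hy]
  | single h r =>
    simp only [extConj_single, extCocycle_val, extCocycle_inv_val,
      MonoidAlgebra.single_mul_single, one_mul, mul_one]
    congr 1
    ext
    simp only [Subgroup.coe_mul, Subgroup.coe_inv, extCocycleElt, kerConj, MulEquiv.coe_mk,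
      Equiv.coe_fn_mk]
    group

lemma condC2_ext (p : G →* Q) (s : Q → G) (hs : ∀ q, p (s q) = q) :
    CondC2 (extConj R p s hs) (extCocycle R p s hs) := by
  intro q q' q''
  simp only [extConj_single, extCocycle_val, MonoidAlgebra.single_mul_single, mul_one]
  congr 1
  ext
  simp only [Subgroup.coe_mul, extCocycleElt, kerConj, MulEquiv.coe_mk, Equiv.coe_fn_mk,
    mul_assoc q q' q'']
  group

lemma condC3_ext (p : G →* Q) (s : Q → G) (hs : ∀ q, p (s q) = q) (hse : s 1 = 1) :
    CondC3 (extConj R p s hs) := by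
  have hc : kerConj p s hs 1 = MulEquiv.refl _ := by
    ext h
    simp [kerConj, hse]
  ext1 x
  simp [extConj, hc]

lemma condC4_ext (p : G →* Q) (s : Q → G) (hs : ∀ q, p (s q) = q) (hse : s 1 = 1) :
    CondC4 (extCocycle R p s hs) := by
  intro q
  have hc : extCocycleElt p s hs 1 q = 1 := by
    ext
    simp [extCocycleElt, hse]
  simp [extCocycle, hc]

lemma condC5_ext (p : G →* Q) (s : Q → G) (hs : ∀ q, p (s q) = q) (hse : s 1 = 1) :
    CondC5 (extCocycle R p s hs) := by
  intro q
  have hc : extCocycleElt p s hs q 1 = 1 := by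
    ext
    simp [extCocycleElt, hse]
  simp [extCocycle, hc]

/-- `extCompare` as an additive homomorphism. -/
noncomputable def extCompareHom (p : G →* Q) (s : Q → G) :
    (Q →₀ MonoidAlgebra R ↥p.ker) →+ MonoidAlgebra R G :=
  Finsupp.liftAddHom fun q =>
    (AddMonoidHom.mulRight (MonoidAlgebra.single (s q) (1 : R))).comp
      (MonoidAlgebra.mapDomainRingHom R p.ker.subtype).toAddMonoidHom

lemma extCompareHom_apply (p : G →* Q) (s : Q → G) (x : Q →₀ MonoidAlgebra R ↥p.ker) :
    extCompareHom R p s x = extCompare R p s x := rfl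

variable {R} in
lemma extCompare_single (p : G →* Q) (s : Q → G) (q : Q) (a : MonoidAlgebra R ↥p.ker) :
    extCompare R p s (Finsupp.single q a) =
      MonoidAlgebra.mapDomainRingHom R p.ker.subtype a * MonoidAlgebra.single (s q) 1 := by
  simp [extCompare]

variable {R} in
lemma single_mul_mapDomain_ker (p : G →* Q) (s : Q → G) (hs : ∀ q, p (s q) = q) (q : Q)
    (a : MonoidAlgebra R ↥p.ker) :
    MonoidAlgebra.single (s q) 1 * MonoidAlgebra.mapDomainRingHom R p.ker.subtype a =
      MonoidAlgebra.mapDomainRingHom R p.ker.subtype (extConj R p s hs q a) *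
        MonoidAlgebra.single (s q) 1 := by
  induction a using MonoidAlgebra.induction_linear with
  | zero => simp
  | add x y hx hy => simp only [map_add, mul_add, add_mul, hx, hy]
  | single h r => simp [extConj_single, MonoidAlgebra.single_mul_single, kerConj]

lemma mapDomain_extCocycle_mul_single (p : G →* Q) (s : Q → G) (hs : ∀ q, p (s q) = q)
    (q q' : Q) :
    MonoidAlgebra.mapDomainRingHom R p.ker.subtype (extCocycle R p s hs q q') *
        MonoidAlgebra.single (s (q * q')) 1 =
      MonoidAlgebra.single (s q) 1 * MonoidAlgebra.single (s q') 1 := by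
  simp [extCocycle_val, MonoidAlgebra.single_mul_single, extCocycleElt]

lemma extCompare_crossedMul (p : G →* Q) (s : Q → G) (hs : ∀ q, p (s q) = q)
    (x y : Q →₀ MonoidAlgebra R ↥p.ker) :
    extCompare R p s (crossedMul (extConj R p s hs) (extCocycle R p s hs) x y) =
      extCompare R p s x * extCompare R p s y := by
  rw [crossedMul, ← extCompareHom_apply, map_finsuppSum]
  simp only [map_finsuppSum, extCompareHom_apply, extCompare_single]
  rw [extCompare, extCompare, Finsupp.sum_mul]
  refine Finsupp.sum_congr fun q _ => ?_
  rw [Finsupp.mul_sum]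
  refine Finsupp.sum_congr fun q' _ => ?_
  rw [map_mul, map_mul, mul_assoc, mapDomain_extCocycle_mul_single, mul_assoc, ← mul_assoc _
    (MonoidAlgebra.single (s q) 1), ← single_mul_mapDomain_ker]
  simp only [mul_assoc]

/-- The inverse of `extCompare`, sending `g` to `(g·s(p g)⁻¹)·p(g)`. -/
noncomputable def extCompareInv (p : G →* Q) (s : Q → G) (hs : ∀ q, p (s q) = q) :
    MonoidAlgebra R G →+ (Q →₀ MonoidAlgebra R ↥p.ker) :=
  (Finsupp.liftAddHom fun g =>
    (Finsupp.singleAddHom (p g)).comp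
      (MonoidAlgebra.singleAddHom (R := R)
        (⟨g * (s (p g))⁻¹, by simp [MonoidHom.mem_ker, hs]⟩ : p.ker))).comp
    MonoidAlgebra.coeffAddEquiv.toAddMonoidHom

variable {R} in
lemma extCompareInv_single (p : G →* Q) (s : Q → G) (hs : ∀ q, p (s q) = q) (g : G) (r : R) :
    extCompareInv R p s hs (MonoidAlgebra.single g r) =
      Finsupp.single (p g) (MonoidAlgebra.single
        (⟨g * (s (p g))⁻¹, by simp [MonoidHom.mem_ker, hs]⟩ : p.ker) r) :=
  Finsupp.liftAddHom_apply_single _ _ _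

lemma extCompare_extCompareInv (p : G →* Q) (s : Q → G) (hs : ∀ q, p (s q) = q)
    (x : MonoidAlgebra R G) : extCompare R p s (extCompareInv R p s hs x) = x := by
  rw [← extCompareHom_apply]
  induction x using MonoidAlgebra.induction_linear with
  | zero => simp
  | add x y hx hy => simp only [map_add, hx, hy]
  | single g r =>
    simp [extCompareInv_single, extCompareHom_apply, extCompare_single,
      MonoidAlgebra.single_mul_single]

lemma extCompareInv_extCompare (p : G →* Q) (s : Q → G) (hs : ∀ q, p (s q) = q)
    (x : Q →₀ MonoidAlgebra R ↥p.ker) : extCompareInv R p s hs (extCompare R p s x) = x := by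
  rw [← extCompareHom_apply]
  induction x using Finsupp.induction_linear with
  | zero => simp
  | add x y hx hy => simp only [map_add, hx, hy]
  | single q a =>
    rw [extCompareHom_apply, extCompare_single]
    induction a using MonoidAlgebra.induction_linear with
    | zero => simp
    | add a b ha hb => simp only [map_add, add_mul, Finsupp.single_add, ha, hb]
    | single h r =>
      have hh : p (h : G) = 1 := h.2
      simp [MonoidAlgebra.single_mul_single, extCompareInv_single, hh, hs]

/-- for a group extension `1 → H → G → Q → 1` with set-theoretic section `s`
(`p ∘ s = id`, `s(e) = e`), the data
`c_q(Σ λ_h·h) = Σ λ_h·(s(q)·h·s(q)⁻¹)` and `τ(q,q') = s(q)·s(q')·s(qq')⁻¹ ∈ (R[H])ˣ`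
satisfy the crossed-product conditions (C1)–(C5), and the map
`R[H] ∗_{c,τ} Q → R[G]`, `Σ_q λ_q·q ↦ Σ_q i(λ_q)·s(q)`, is a ring isomorphism
(additive, multiplicative, unital and bijective). -/
theorem group_ring_as_crossed_product
    (p : G →* Q) (hp : Function.Surjective p) (s : Q → G)
    (hs : ∀ q, p (s q) = q) (hse : s 1 = 1) :
    CondC1 (extConj R p s hs) (extCocycle R p s hs) ∧
    CondC2 (extConj R p s hs) (extCocycle R p s hs) ∧
    CondC3 (extConj R p s hs) ∧
    CondC4 (extCocycle R p s hs) ∧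
    CondC5 (extCocycle R p s hs) ∧
    (∀ x y : Q →₀ MonoidAlgebra R ↥p.ker,
      extCompare R p s (x + y) = extCompare R p s x + extCompare R p s y) ∧
    (∀ x y : Q →₀ MonoidAlgebra R ↥p.ker,
      extCompare R p s (crossedMul (extConj R p s hs) (extCocycle R p s hs) x y) =
        extCompare R p s x * extCompare R p s y) ∧
    extCompare R p s (Finsupp.single (1 : Q) (1 : MonoidAlgebra R ↥p.ker)) = 1 ∧
    Function.Bijective (extCompare R p s) := by
  refine ⟨condC1_ext R p s hs, condC2_ext R p s hs, condC3_ext R p s hs hse,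
    condC4_ext R p s hs hse, condC5_ext R p s hs hse, map_add (extCompareHom R p s),
    extCompare_crossedMul R p s hs, ?_,
    Function.bijective_iff_has_inverse.mpr ⟨extCompareInv R p s hs,
      extCompareInv_extCompare R p s hs, extCompare_extCompareInv R p s hs⟩⟩
  rw [extCompare_single, map_one, one_mul, hse, MonoidAlgebra.one_def]

end Extension
end

section
/- Suppose the crossed-product conditions (C1)–(C5) hold. Then for all g,h ∈ G one has the identity in R: τ(g,h) = c_{gh}( τ((gh)⁻¹,gh)⁻¹ · τ(h⁻¹,g⁻¹)⁻¹ · c_{h⁻¹}(τ(g⁻¹,g)) · τ(h⁻¹,h) ). -/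
universe u v

variable {R : Type u} [Ring R] {G : Type v} [Group G]

/-- under (C1)–(C5), for all `g h ∈ G`,
`τ(g,h) = c_{gh}( τ((gh)⁻¹,gh)⁻¹ · τ(h⁻¹,g⁻¹)⁻¹ · c_{h⁻¹}(τ(g⁻¹,g)) · τ(h⁻¹,h) )`. -/
theorem tau_conjugation_identity_of_crossed_product_conditions
    (c : G → R ≃+* R) (τ : G → G → Rˣ)
    (h1 : CondC1 c τ) (h2 : CondC2 c τ) (h3 : CondC3 c) (h4 : CondC4 τ) (h5 : CondC5 τ) :
    ∀ g h : G,
      ((τ g h : Rˣ) : R) =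
        c (g * h) ((((τ (g * h)⁻¹ (g * h))⁻¹ : Rˣ) : R) * (((τ h⁻¹ g⁻¹)⁻¹ : Rˣ) : R) *
          c h⁻¹ ((τ g⁻¹ g : Rˣ) : R) * ((τ h⁻¹ h : Rˣ) : R)) := by
  intro g h
  have cocycle_left : (((τ h⁻¹ g⁻¹)⁻¹ : Rˣ) : R) * c h⁻¹ ((τ g⁻¹ g : Rˣ) : R) =
      ((τ (g * h)⁻¹ g : Rˣ) : R) := by
    have e := h2 h⁻¹ g⁻¹ g
    rw [inv_mul_cancel, h5, Units.val_one, mul_one, ← mul_inv_rev] at e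
    rw [← e, Units.inv_mul_cancel_left]
  have cocycle_right : ((τ (g * h)⁻¹ g : Rˣ) : R) * ((τ h⁻¹ h : Rˣ) : R) =
      c (g * h)⁻¹ ((τ g h : Rˣ) : R) * ((τ (g * h)⁻¹ (g * h) : Rˣ) : R) := by
    have e := h2 (g * h)⁻¹ g h
    rwa [show (g * h)⁻¹ * g = h⁻¹ by group] at e
  obtain ⟨x, hx⟩ := (c (g * h)).surjective ((τ g h : Rˣ) : R)
  have conj := h1 (g * h)⁻¹ (g * h) x
  rw [inv_mul_cancel, h3, RingEquiv.refl_apply, hx] at conj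
  rw [mul_assoc _ _ (c h⁻¹ _), cocycle_left, mul_assoc, cocycle_right, ← conj,
    Units.inv_mul_cancel_right, Units.inv_mul_cancel_left, hx]
end

section
/- Let φ : K → G be a group homomorphism and let ξ be a left G-set; regard ξ also as a K-set via φ. Let the group G × K act on the left on the set G × ξ by (g,k)·(x,y) = (φ(k)·x·g⁻¹, g·y). Then the assignment sending an object (x,y) of the action groupoid of G × K on G × ξ to the object x·y of the action groupoid of K on ξ, and sending a morphism (x₁,y₁) → (x₂,y₂) given by a group element (g,k) (so that φ(k)·x₁·g⁻¹ = x₂ and g·y₁ = y₂) to the morphism x₁·y₁ → x₂·y₂ given by k, is a well-defined functor, and this functor is fully faithful and essentially surjective, hence an equivalence of categories. -/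
open CategoryTheory

universe u v

variable {K G : Type u} [Group K] [Group G]

/-- The action groupoid of `G × K` acting on `G × ξ` by
`(g,k)·(x,y) = (φ(k)·x·g⁻¹, g·y)`, for a group homomorphism `φ : K → G` and a `G`-set `ξ`. -/
def BisetGroupoid (_φ : K →* G) (ξ : Type v) [MulAction G ξ] : Type max u v := G × ξ

instance BisetGroupoid.category (φ : K →* G) (ξ : Type v) [MulAction G ξ] :
    Category (BisetGroupoid φ ξ) where
  Hom a b := {p : G × K // φ p.2 * a.1 * p.1⁻¹ = b.1 ∧ p.1 • a.2 = b.2}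
  id a := ⟨(1, 1), by simp⟩
  comp {a b c} f g := ⟨(g.1.1 * f.1.1, g.1.2 * f.1.2), by
    obtain ⟨⟨g1, k1⟩, hf1, hf2⟩ := f
    obtain ⟨⟨g2, k2⟩, hg1, hg2⟩ := g
    dsimp only at hf1 hf2 hg1 hg2 ⊢
    constructor
    · rw [← hg1, ← hf1]
      simp [map_mul, mul_inv_rev, mul_assoc]
    · rw [mul_smul, hf2, hg2]⟩
  id_comp f := by
    apply Subtype.ext
    simp
  comp_id f := by
    apply Subtype.ext
    simp
  assoc f g h := by
    apply Subtype.ext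
    simp [mul_assoc]

/-- The action groupoid of `K` acting on a `G`-set `ξ` via `φ : K → G`:
objects are the elements of `ξ`, morphisms `y₁ → y₂` are elements `k ∈ K` with
`φ(k)·y₁ = y₂`. -/
def ResGroupoid (_φ : K →* G) (ξ : Type v) [MulAction G ξ] : Type v := ξ

/-- The underlying element of `ξ` of an object of the action groupoid. -/
def ResGroupoid.pt {φ : K →* G} {ξ : Type v} [MulAction G ξ] (y : ResGroupoid φ ξ) : ξ := y

instance ResGroupoid.category (φ : K →* G) (ξ : Type v) [MulAction G ξ] :
    Category (ResGroupoid φ ξ) where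
  Hom y₁ y₂ := {k : K // φ k • y₁.pt = y₂.pt}
  id y := ⟨1, by simp⟩
  comp {x y z} f g := ⟨g.1 * f.1, by rw [map_mul, mul_smul, f.2, g.2]⟩
  id_comp f := by
    apply Subtype.ext
    simp
  comp_id f := by
    apply Subtype.ext
    simp
  assoc f g h := by
    apply Subtype.ext
    simp [mul_assoc]

/-- The object part of the comparison functor: `(x,y) ↦ x·y`. -/
def bisetToRes (φ : K →* G) (ξ : Type v) [MulAction G ξ] (a : BisetGroupoid φ ξ) :
    ResGroupoid φ ξ :=
  show ξ from a.1 • a.2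

/-- The morphism part of the comparison functor: a morphism `(x₁,y₁) → (x₂,y₂)` given by
`(g,k)` (so `φ(k)·x₁·g⁻¹ = x₂` and `g·y₁ = y₂`) is sent to the morphism `x₁·y₁ → x₂·y₂`
given by `k`. -/
def bisetToResMap (φ : K →* G) (ξ : Type v) [MulAction G ξ] {a b : BisetGroupoid φ ξ}
    (f : a ⟶ b) : bisetToRes φ ξ a ⟶ bisetToRes φ ξ b :=
  ⟨f.1.2, by
    obtain ⟨⟨g, k⟩, h1, h2⟩ := f
    dsimp only at h1 h2 ⊢
    show φ k • (a.1 • a.2) = b.1 • b.2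
    rw [← h1, ← h2]
    simp only [smul_smul]
    congr 1
    group⟩

/-- The comparison functor from the action groupoid of `G × K` on `G × ξ` to the action
groupoid of `K` on `ξ`. -/
def bisetToResFunctor (φ : K →* G) (ξ : Type v) [MulAction G ξ] :
    BisetGroupoid φ ξ ⥤ ResGroupoid φ ξ where
  obj := bisetToRes φ ξ
  map := bisetToResMap φ ξ
  map_id _ := rfl
  map_comp _ _ := rfl

theorem bisetToResMap_injective (φ : K →* G) (ξ : Type v) [MulAction G ξ]
    (a b : BisetGroupoid φ ξ) :
    Function.Injective (fun f : a ⟶ b => bisetToResMap φ ξ f) := by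
  rintro ⟨⟨g, k⟩, hg, hy⟩ ⟨⟨g', k'⟩, hg', hy'⟩ h
  obtain rfl : k = k' := congrArg Subtype.val h
  dsimp only at hg hg'
  obtain rfl : g = g' := inv_injective (mul_left_cancel (hg.trans hg'.symm))
  rfl

theorem bisetToResMap_surjective (φ : K →* G) (ξ : Type v) [MulAction G ξ]
    (a b : BisetGroupoid φ ξ) :
    Function.Surjective (fun f : a ⟶ b => bisetToResMap φ ξ f) := by
  rintro ⟨k, hk⟩
  change φ k • a.1 • a.2 = b.1 • b.2 at hk
  refine ⟨⟨(b.1⁻¹ * φ k * a.1, k), ?_, ?_⟩, rfl⟩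
  · dsimp only
    group
  · rw [mul_smul, mul_smul, hk, inv_smul_smul]

theorem bisetToRes_one_mk (φ : K →* G) (ξ : Type v) [MulAction G ξ] (t : ResGroupoid φ ξ) :
    bisetToRes φ ξ (1, t.pt) = t :=
  one_smul G t.pt

/-- for a group homomorphism `φ : K → G` and a `G`-set `ξ`, the assignment
`(x,y) ↦ x·y`, `(g,k) ↦ k` is a well-defined functor from the action groupoid of `G × K`
acting on `G × ξ` by `(g,k)·(x,y) = (φ(k)·x·g⁻¹, g·y)` to the action groupoid of `K` acting
on `ξ` via `φ`; this functor is fully faithful and essentially surjective, hence an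
equivalence of categories. -/
theorem biset_groupoid_equivalence
    (φ : K →* G) (ξ : Type v) [MulAction G ξ] :
    (∀ a : BisetGroupoid φ ξ, bisetToResMap φ ξ (𝟙 a) = 𝟙 (bisetToRes φ ξ a)) ∧
    (∀ (a b c : BisetGroupoid φ ξ) (f : a ⟶ b) (g : b ⟶ c),
      bisetToResMap φ ξ (f ≫ g) = bisetToResMap φ ξ f ≫ bisetToResMap φ ξ g) ∧
    (∀ a b : BisetGroupoid φ ξ,
      Function.Bijective (fun f : a ⟶ b => bisetToResMap φ ξ f)) ∧
    (∀ t : ResGroupoid φ ξ, ∃ a : BisetGroupoid φ ξ, Nonempty (bisetToRes φ ξ a ≅ t)) ∧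
    Nonempty (BisetGroupoid φ ξ ≌ ResGroupoid φ ξ) := by
  have bijective (a b : BisetGroupoid φ ξ) :
      Function.Bijective (fun f : a ⟶ b => bisetToResMap φ ξ f) :=
    ⟨bisetToResMap_injective φ ξ a b, bisetToResMap_surjective φ ξ a b⟩
  have essSurj (t : ResGroupoid φ ξ) :
      ∃ a : BisetGroupoid φ ξ, Nonempty (bisetToRes φ ξ a ≅ t) :=
    ⟨(1, t.pt), ⟨eqToIso (bisetToRes_one_mk φ ξ t)⟩⟩
  have : (bisetToResFunctor φ ξ).Faithful := ⟨fun {a b} => (bijective a b).1⟩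
  have : (bisetToResFunctor φ ξ).Full := ⟨fun {a b} => (bijective a b).2⟩
  have : (bisetToResFunctor φ ξ).EssSurj := ⟨essSurj⟩
  have : (bisetToResFunctor φ ξ).IsEquivalence := { }
  exact ⟨(bisetToResFunctor φ ξ).map_id, fun _ _ _ => (bisetToResFunctor φ ξ).map_comp,
    bijective, essSurj, ⟨(bisetToResFunctor φ ξ).asEquivalence⟩⟩
end
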